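/- arXiv:1206.5182 — 3 statements merged into one kernel-verified Lean document; each statement's English description precedes it below -/
import Mathlib

section
/- Assume: (A1) there exists σ > 0 such that the central limit theorem holds for the continuous-time walk, i.e. lim_{t→∞} ℙ^0(Y_t/√t ≤ x) = ∫_{−∞}^x φ_{σ²}(ξ) dξ for all x ∈ ℝ; (A2) there exists μ > 0 such that lim_{T→∞} (1/(y−x)) ∫_x^y (1/ω_{⌊Tξ⌋}) dξ = μ for every pair of real numbers x < y; (A3) sup_{t≥0} sup_{k∈ℤ} √t · (𝒫^t)_{0,k} < ∞. Then the local limit theorem holds: for every compact set I ⊂ ℝ, lim_{t→∞} sup_{x∈I} | ω_{⌊√t·x⌋} · √t · ℙ^0(Y_t = ⌊√t·x⌋) − (1/μ)·φ_{σ²}(x) | = 0. -/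
open Filter MeasureTheory Topology

/-- `(P^n)_{k,j}` for the balanced walk on `ℤ` with transition probabilities
`P_{k,k-1} = P_{k,k+1} = ω k`, `P_{k,k} = 1 - 2 ω k`. -/
noncomputable def Ppow (ω : ℤ → ℝ) : ℕ → ℤ → ℤ → ℝ
  | 0, k, j => if k = j then 1 else 0
  | n + 1, k, j =>
      ω k * Ppow ω n (k - 1) j + (1 - 2 * ω k) * Ppow ω n k j + ω k * Ppow ω n (k + 1) j

/-- The continuous-time semigroup `(𝒫^t)_{k,j} = e^{-t} Σ_n t^n/n! (P^n)_{k,j}`. -/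
noncomputable def calP (ω : ℤ → ℝ) (t : ℝ) (k j : ℤ) : ℝ :=
  Real.exp (-t) * ∑' n : ℕ, t ^ n / (Nat.factorial n) * Ppow ω n k j

/-- The centered Gaussian density with variance `σ²`. -/
noncomputable def gauss (σ : ℝ) (x : ℝ) : ℝ :=
  (1 / (Real.sqrt (2 * Real.pi) * σ)) * Real.exp (-x ^ 2 / (2 * σ ^ 2))

/-! ### Transition probabilities -/

section Transition

variable {ω : ℤ → ℝ}

lemma Ppow_nonneg (hω : ∀ k, 0 < ω k ∧ ω k ≤ 1 / 2) (n : ℕ) (k j : ℤ) : 0 ≤ Ppow ω n k j := by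
  induction n generalizing k with
  | zero => simp only [Ppow]; split_ifs <;> norm_num
  | succ n ih =>
    have h := hω k
    have h₁ : 0 ≤ 1 - 2 * ω k := by linarith
    have := ih k
    have := ih (k - 1)
    have := ih (k + 1)
    have := h.1
    simp only [Ppow]
    positivity

lemma hasSum_Ppow (n : ℕ) (k : ℤ) : HasSum (Ppow ω n k) 1 := by
  induction n generalizing k with
  | zero =>
    have := hasSum_ite_eq k (1 : ℝ)
    refine this.congr_fun ?_
    intro j
    simp [Ppow, eq_comm]
  | succ n ih =>
    have := (((ih (k - 1)).mul_left (ω k)).add ((ih k).mul_left (1 - 2 * ω k))).add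
      ((ih (k + 1)).mul_left (ω k))
    have hone : ω k * 1 + (1 - 2 * ω k) * 1 + ω k * 1 = 1 := by ring
    rwa [hone] at this

lemma Ppow_le_one (hω : ∀ k, 0 < ω k ∧ ω k ≤ 1 / 2) (n : ℕ) (k j : ℤ) : Ppow ω n k j ≤ 1 :=
  le_hasSum (hasSum_Ppow n k) j fun i _ => Ppow_nonneg hω n k i

/-- The forward (Fokker–Planck) recursion. -/
lemma Ppow_succ_forward (n : ℕ) (k j : ℤ) :
    Ppow ω (n + 1) k j = ω (j - 1) * Ppow ω n k (j - 1) + (1 - 2 * ω j) * Ppow ω n k j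
      + ω (j + 1) * Ppow ω n k (j + 1) := by
  induction n generalizing k with
  | zero =>
    simp only [Ppow]
    by_cases h₁ : k = j
    · subst h₁
      have : ¬ (k = k - 1) := by omega
      simp [this]
    by_cases h₂ : k = j - 1
    · subst h₂
      have : ¬ (j - 1 = j + 1) := by omega
      have : ¬ (j - 1 - 1 = j) := by omega
      simp [*]
    by_cases h₃ : k = j + 1
    · subst h₃
      have : ¬ (j + 1 = j - 1) := by omega
      have : ¬ (j + 1 + 1 = j) := by omega
      simp [*]
    have : ¬ (k - 1 = j) := by omega
    have : ¬ (k + 1 = j) := by omega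
    simp [*]
  | succ n ih =>
    have step (m : ℕ) (i : ℤ) : Ppow ω (m + 1) k i = ω k * Ppow ω m (k - 1) i
        + (1 - 2 * ω k) * Ppow ω m k i + ω k * Ppow ω m (k + 1) i := rfl
    linear_combination step (n + 1) j + ω k * ih (k - 1) + (1 - 2 * ω k) * ih k
      + ω k * ih (k + 1) - ω (j - 1) * step n (j - 1) - (1 - 2 * ω j) * step n j
      - ω (j + 1) * step n (j + 1)

/-- Reversibility with respect to the weights `1 / ω`. -/
lemma Ppow_reversible (n : ℕ) (k j : ℤ) : ω j * Ppow ω n k j = ω k * Ppow ω n j k := by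
  induction n generalizing j with
  | zero =>
    simp only [Ppow]
    by_cases h : k = j
    · subst h; simp
    · simp [h, Ne.symm h]
  | succ n ih =>
    rw [Ppow_succ_forward, Ppow]
    linear_combination ω j * ih (j - 1) + (1 - 2 * ω j) * ih j + ω j * ih (j + 1)

lemma summable_poisson_Ppow (hω : ∀ k, 0 < ω k ∧ ω k ≤ 1 / 2) {t : ℝ} (ht : 0 ≤ t) (k j : ℤ) :
    Summable fun n : ℕ => t ^ n / (Nat.factorial n) * Ppow ω n k j := by
  refine Summable.of_nonneg_of_le (fun n => ?_) (fun n => ?_) (Real.summable_pow_div_factorial t)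
  · have := Ppow_nonneg hω n k j
    positivity
  · exact mul_le_of_le_one_right (by positivity) (Ppow_le_one hω n k j)

lemma calP_nonneg (hω : ∀ k, 0 < ω k ∧ ω k ≤ 1 / 2) {t : ℝ} (ht : 0 ≤ t) (k j : ℤ) :
    0 ≤ calP ω t k j := by
  refine mul_nonneg (Real.exp_pos _).le (tsum_nonneg fun n => ?_)
  have := Ppow_nonneg hω n k j
  positivity

lemma calP_reversible (t : ℝ) (k j : ℤ) : ω j * calP ω t k j = ω k * calP ω t j k := by
  have h : ω j * ∑' n : ℕ, t ^ n / (Nat.factorial n) * Ppow ω n k j =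
      ω k * ∑' n : ℕ, t ^ n / (Nat.factorial n) * Ppow ω n j k := by
    rw [← tsum_mul_left, ← tsum_mul_left]
    refine tsum_congr fun n => ?_
    linear_combination (t ^ n / (Nat.factorial n)) * Ppow_reversible n k j
  simp only [calP]
  linear_combination Real.exp (-t) * h

lemma hasSum_calP (hω : ∀ k, 0 < ω k ∧ ω k ≤ 1 / 2) {t : ℝ} (ht : 0 ≤ t) (k : ℤ) :
    HasSum (calP ω t k) 1 := by
  let F : ℕ × ℤ → ℝ := fun p => t ^ p.1 / (Nat.factorial p.1) * Ppow ω p.1 k p.2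
  have hrow : ∀ n, HasSum (fun j => F (n, j)) (t ^ n / (Nat.factorial n)) := fun n => by
    simpa using (hasSum_Ppow (ω := ω) n k).mul_left (t ^ n / (Nat.factorial n : ℝ))
  have hF : Summable F := by
    refine (summable_prod_of_nonneg fun p => ?_).2 ⟨fun n => (hrow n).summable, ?_⟩
    · have := Ppow_nonneg hω p.1 k p.2
      simp only [F, Pi.zero_apply]
      positivity
    · simpa only [(hrow _).tsum_eq] using Real.summable_pow_div_factorial t
  have hexp : HasSum (fun n : ℕ => t ^ n / (Nat.factorial n)) (Real.exp t) := by
    rw [Real.exp_eq_exp_ℝ]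
    exact NormedSpace.expSeries_div_hasSum_exp t
  have htot : HasSum F (Real.exp t) := by
    have := hF.hasSum.prod_fiberwise hrow
    rw [hexp.unique this]
    exact hF.hasSum
  have hswap : HasSum (fun p : ℤ × ℕ => F p.swap) (Real.exp t) :=
    (Equiv.prodComm ℤ ℕ).hasSum_iff.2 htot
  have := (hswap.prod_fiberwise
    (fun j => (summable_poisson_Ppow hω ht k j).hasSum)).mul_left (Real.exp (-t))
  rwa [← Real.exp_add, neg_add_cancel, Real.exp_zero] at this

end Transition

/-! ### Energy decay for gradient flows in Hilbert space -/

/-- For the gradient flow of `‖B w‖² / 2`, the energy `‖B w‖²` at time `t` is at most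
`‖w (t / 2)‖² / t`. -/
lemma energy_decay {E F : Type*} [NormedAddCommGroup E] [InnerProductSpace ℝ E] [CompleteSpace E]
    [NormedAddCommGroup F] [InnerProductSpace ℝ F] [CompleteSpace F] (B : E →L[ℝ] F) {w : ℝ → E}
    (hw : ∀ t, HasDerivAt w (-(B.adjoint (B (w t)))) t) {t : ℝ} (ht : 0 < t) :
    t * ‖B (w t)‖ ^ 2 ≤ ‖w (t / 2)‖ ^ 2 := by
  have hnorm : ∀ s, HasDerivAt (fun s => ‖w s‖ ^ 2) (-2 * ‖B (w s)‖ ^ 2) s := fun s => by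
    convert (hw s).norm_sq using 1
    rw [inner_neg_right, ContinuousLinearMap.adjoint_inner_right, real_inner_self_eq_norm_sq]
    ring
  have henergy : ∀ s, HasDerivAt (fun s => ‖B (w s)‖ ^ 2)
      (-2 * ‖B.adjoint (B (w s))‖ ^ 2) s := fun s => by
    have hB : HasDerivAt (fun s => B (w s)) (B (-(B.adjoint (B (w s))))) s :=
      B.hasFDerivAt.comp_hasDerivAt s (hw s)
    convert hB.norm_sq using 1
    rw [map_neg, inner_neg_right, ← ContinuousLinearMap.adjoint_inner_left,
      real_inner_self_eq_norm_sq]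
    ring
  have hanti : Antitone fun s => ‖B (w s)‖ ^ 2 := by
    refine antitone_of_deriv_nonpos (fun s => (henergy s).differentiableAt) fun s => ?_
    rw [(henergy s).deriv]
    nlinarith [sq_nonneg ‖B.adjoint (B (w s))‖]
  obtain ⟨c, hc, hslope⟩ := exists_hasDerivAt_eq_slope (fun s => ‖w s‖ ^ 2)
    (fun s => -2 * ‖B (w s)‖ ^ 2) (half_lt_self ht)
    (fun s _ => (hnorm s).continuousAt.continuousWithinAt) fun s _ => hnorm s
  have hle := hanti hc.2.le
  rw [eq_div_iff (by linarith)] at hslope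
  simp only at hle
  nlinarith [sq_nonneg ‖w t‖, mul_le_mul_of_nonneg_left hle ht.le]

/-! ### The weighted gradient on `ℓ²(ℤ)` -/

section Gradient

/-- The Hilbert space `ℓ²(ℤ)`. -/
abbrev EllTwo : Type := lp (fun _ : ℤ => ℝ) 2

lemma EllTwo.hasSum_sq (u : EllTwo) : HasSum (fun k => u k ^ 2) (‖u‖ ^ 2) := by
  have := lp.hasSum_inner (𝕜 := ℝ) u u
  rw [real_inner_self_eq_norm_sq] at this
  simpa [pow_two] using this

lemma memℓp_two_of_summable_sq {f : ℤ → ℝ} (hf : Summable fun k => f k ^ 2) :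
    Memℓp (E := fun _ : ℤ => ℝ) f 2 :=
  memℓp_gen (by simpa using hf)

lemma weightedGradient_sq_le {ω : ℤ → ℝ} (hω : ∀ k, 0 < ω k ∧ ω k ≤ 1 / 2) (u : ℤ → ℝ) (k : ℤ) :
    (√(ω (k + 1)) * u (k + 1) - √(ω k) * u k) ^ 2 ≤ u (k + 1) ^ 2 + u k ^ 2 := by
  have h₁ := Real.sq_sqrt (hω (k + 1)).1.le
  have h₂ := Real.sq_sqrt (hω k).1.le
  have h₃ := mul_le_mul_of_nonneg_right (hω (k + 1)).2 (sq_nonneg (u (k + 1)))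
  have h₄ := mul_le_mul_of_nonneg_right (hω k).2 (sq_nonneg (u k))
  have h₅ := sq_nonneg (√(ω (k + 1)) * u (k + 1) + √(ω k) * u k)
  rw [← h₁] at h₃
  rw [← h₂] at h₄
  nlinarith

/-- The linear map `u ↦ ∇(√ω u)` on `ℓ²(ℤ)`. -/
noncomputable def weightedGradientLinear (ω : ℤ → ℝ) (hω : ∀ k, 0 < ω k ∧ ω k ≤ 1 / 2) :
    EllTwo →ₗ[ℝ] EllTwo where
  toFun u := ⟨fun k => √(ω (k + 1)) * u (k + 1) - √(ω k) * u k,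
    memℓp_two_of_summable_sq <| Summable.of_nonneg_of_le (fun _ => sq_nonneg _)
      (weightedGradient_sq_le hω u)
      (((Equiv.addRight (1 : ℤ)).summable_iff.2 u.hasSum_sq.summable).add u.hasSum_sq.summable)⟩
  map_add' u v := by
    ext k
    simp only [lp.coeFn_add, Pi.add_apply]
    ring
  map_smul' c u := by
    ext k
    simp only [lp.coeFn_smul, Pi.smul_apply, smul_eq_mul, RingHom.id_apply]
    ring

lemma norm_weightedGradientLinear_le {ω : ℤ → ℝ} (hω : ∀ k, 0 < ω k ∧ ω k ≤ 1 / 2) (u : EllTwo) :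
    ‖weightedGradientLinear ω hω u‖ ≤ √2 * ‖u‖ := by
  refine (sq_le_sq₀ (norm_nonneg _) (by positivity)).1 ?_
  rw [mul_pow, Real.sq_sqrt zero_le_two, two_mul]
  have hshift : HasSum (fun k => u (k + 1) ^ 2) (‖u‖ ^ 2) :=
    (Equiv.addRight (1 : ℤ)).hasSum_iff.2 u.hasSum_sq
  exact hasSum_le (weightedGradient_sq_le hω u)
    (weightedGradientLinear ω hω u).hasSum_sq (hshift.add u.hasSum_sq)

/-- The bounded operator `u ↦ ∇(√ω u)` on `ℓ²(ℤ)`. -/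
noncomputable def weightedGradient (ω : ℤ → ℝ) (hω : ∀ k, 0 < ω k ∧ ω k ≤ 1 / 2) :
    EllTwo →L[ℝ] EllTwo :=
  (weightedGradientLinear ω hω).mkContinuous √2 (norm_weightedGradientLinear_le hω)

variable {ω : ℤ → ℝ} (hω : ∀ k, 0 < ω k ∧ ω k ≤ 1 / 2)

lemma weightedGradient_apply (u : EllTwo) (k : ℤ) :
    weightedGradient ω hω u k = √(ω (k + 1)) * u (k + 1) - √(ω k) * u k := rfl

lemma weightedGradient_adjoint_apply (u : EllTwo) (k : ℤ) :
    (weightedGradient ω hω).adjoint u k = √(ω k) * (u (k - 1) - u k) := by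
  have h₁ : weightedGradient ω hω (lp.single 2 k 1) =
      lp.single 2 (k - 1) (√(ω k)) - lp.single 2 k (√(ω k)) := by
    ext j
    rw [weightedGradient_apply]
    simp only [lp.coeFn_sub, Pi.sub_apply, lp.single_apply, Pi.single_apply]
    by_cases h : j = k
    · subst h
      have : ¬ (j = j - 1) := by omega
      simp [this]
    by_cases h' : j = k - 1
    · subst h'; simp
    have : ¬ (j + 1 = k) := by omega
    simp [*]
  have h₂ := lp.inner_single_left (𝕜 := ℝ) (G := fun _ : ℤ => ℝ) k 1
    ((weightedGradient ω hω).adjoint u)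
  rw [ContinuousLinearMap.adjoint_inner_right, h₁, inner_sub_left, lp.inner_single_left,
    lp.inner_single_left] at h₂
  simp only [RCLike.inner_apply, conj_trivial, mul_one] at h₂
  rw [← h₂]
  ring

/-- The symmetrized transition operator `1 - ∇† ∇`. -/
noncomputable def symmetrizedTransition : EllTwo →L[ℝ] EllTwo :=
  1 - (weightedGradient ω hω).adjoint ∘L weightedGradient ω hω

lemma symmetrizedTransition_apply (u : EllTwo) (k : ℤ) :
    symmetrizedTransition hω u k = u k - √(ω k) *
      (2 * (√(ω k) * u k) - √(ω (k - 1)) * u (k - 1) - √(ω (k + 1)) * u (k + 1)) := by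
  have h : symmetrizedTransition hω u k =
    u k - (weightedGradient ω hω).adjoint (weightedGradient ω hω u) k := rfl
  rw [h, weightedGradient_adjoint_apply, weightedGradient_apply, weightedGradient_apply,
    sub_add_cancel]
  ring

lemma symmetrizedTransition_pow_apply (n : ℕ) (j k : ℤ) :
    √(ω k) * (symmetrizedTransition hω ^ n) (lp.single 2 j (√(ω j))⁻¹) k = Ppow ω n k j := by
  induction n generalizing k with
  | zero =>
    have := (Real.sqrt_pos.2 (hω j).1).ne'
    by_cases h : k = j
    · subst h; simp [Ppow, this]
    · simp [Ppow, h, lp.single_apply]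
  | succ n ih =>
    rw [pow_succ', Ppow, ← ih, ← ih, ← ih, mul_apply_eq_comp, symmetrizedTransition_apply]
    set v := (symmetrizedTransition hω ^ n) (lp.single 2 j (√(ω j))⁻¹)
    linear_combination (√(ω (k - 1)) * v (k - 1) - 2 * (√(ω k) * v k)
      + √(ω (k + 1)) * v (k + 1)) * Real.mul_self_sqrt (hω k).1.le

/-- The symmetrized heat flow started from a point mass at `j`. -/
noncomputable def symmetrizedFlow (j : ℤ) (t : ℝ) : EllTwo :=
  Real.exp (-t) • NormedSpace.exp (t • symmetrizedTransition hω) (lp.single 2 j (√(ω j))⁻¹)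

lemma symmetrizedFlow_apply (j k : ℤ) (t : ℝ) :
    √(ω k) * symmetrizedFlow hω j t k = calP ω t k j := by
  have h := NormedSpace.exp_series_hasSum_exp' (𝕂 := ℝ) (t • symmetrizedTransition hω)
  have h' := ((lp.evalCLM ℝ (fun _ : ℤ => ℝ) 2 k).hasSum
    ((ContinuousLinearMap.apply ℝ EllTwo (lp.single 2 j (√(ω j))⁻¹ : EllTwo)).hasSum h)).mul_left
      (√(ω k))
  have h'' : HasSum (fun n : ℕ => t ^ n / (Nat.factorial n) * Ppow ω n k j)
      (√(ω k) * NormedSpace.exp (t • symmetrizedTransition hω) (lp.single 2 j (√(ω j))⁻¹) k) := by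
    refine h'.congr_fun fun n => ?_
    rw [← symmetrizedTransition_pow_apply hω n j k]
    have heval (v : EllTwo) : lp.evalCLM ℝ (fun _ : ℤ => ℝ) 2 k v = v k := rfl
    rw [ContinuousLinearMap.apply_apply, smul_pow, smul_smul, smul_apply, map_smul, heval,
      smul_eq_mul]
    ring
  rw [calP, h''.tsum_eq, symmetrizedFlow, lp.coeFn_smul, Pi.smul_apply, smul_eq_mul]
  ring

lemma hasDerivAt_symmetrizedFlow (j : ℤ) (t : ℝ) :
    HasDerivAt (symmetrizedFlow hω j) (-((weightedGradient ω hω).adjoint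
      (weightedGradient ω hω (symmetrizedFlow hω j t)))) t := by
  have h₁ := (hasDerivAt_exp_smul_const' (symmetrizedTransition hω) t).clm_apply
    (hasDerivAt_const t (lp.single 2 j (√(ω j))⁻¹ : EllTwo))
  have h₂ : HasDerivAt (fun s : ℝ => Real.exp (-s)) (-Real.exp (-t)) t := by
    simpa using (hasDerivAt_neg t).exp
  refine (h₂.smul h₁).congr_deriv ?_
  rw [symmetrizedFlow, map_smul, map_smul, map_zero, add_zero, mul_apply_eq_comp]
  set v := NormedSpace.exp (t • symmetrizedTransition hω) (lp.single 2 j (√(ω j))⁻¹)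
  have hv : symmetrizedTransition hω v =
    v - (weightedGradient ω hω).adjoint (weightedGradient ω hω v) := rfl
  rw [hv]
  module

end Gradient

/-! ### Hölder regularity of the heat kernel -/

lemma EllTwo.sum_range_sq_le (u : EllTwo) (k : ℤ) (n : ℕ) :
    ∑ i ∈ Finset.range n, u (k + i) ^ 2 ≤ ‖u‖ ^ 2 := by
  let e : ℕ ↪ ℤ := ⟨fun i => k + i, fun i j h => by simpa using h⟩
  have := sum_le_hasSum ((Finset.range n).map e) (fun i _ => sq_nonneg (u i)) u.hasSum_sq
  rwa [Finset.sum_map] at this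

section Regularity

variable {ω : ℤ → ℝ} (hω : ∀ k, 0 < ω k ∧ ω k ≤ 1 / 2)

lemma calP_sub_sq_le_energy (t : ℝ) (j k : ℤ) (n : ℕ) :
    (calP ω t (k + n) j - calP ω t k j) ^ 2 ≤
      n * ‖weightedGradient ω hω (symmetrizedFlow hω j t)‖ ^ 2 := by
  have hsum : calP ω t (k + n) j - calP ω t k j =
      ∑ i ∈ Finset.range n, weightedGradient ω hω (symmetrizedFlow hω j t) (k + i) := by
    have := Finset.sum_range_sub (fun i : ℕ => calP ω t (k + i) j) n
    rw [Nat.cast_zero, add_zero] at this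
    rw [← this]
    refine Finset.sum_congr rfl fun i _ => ?_
    rw [weightedGradient_apply, symmetrizedFlow_apply, symmetrizedFlow_apply, Nat.cast_succ,
      add_assoc]
  rw [hsum]
  refine (sq_sum_le_card_mul_sum_sq).trans ?_
  rw [Finset.card_range]
  exact mul_le_mul_of_nonneg_left (EllTwo.sum_range_sq_le _ _ _) (Nat.cast_nonneg n)

lemma norm_symmetrizedFlow_sq_le {t M : ℝ} (ht : 0 ≤ t) {j : ℤ}
    (hM : ∀ k, √t * calP ω t j k ≤ M) :
    √t * (ω j ^ 2 * ‖symmetrizedFlow hω j t‖ ^ 2) ≤ M := by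
  have h₁ := (((symmetrizedFlow hω j t).hasSum_sq).mul_left (ω j ^ 2)).mul_left √t
  have h₂ := (hasSum_calP hω ht j).mul_left M
  rw [mul_one] at h₂
  refine hasSum_le (fun k => ?_) h₁ h₂
  have hk := hω k
  have hp := calP_nonneg hω ht j k
  have hflow : ω j * symmetrizedFlow hω j t k = √(ω k) * calP ω t j k := by
    have hs : 0 < √(ω k) := Real.sqrt_pos.2 hk.1
    have hrev := calP_reversible (ω := ω) t j k
    rw [← symmetrizedFlow_apply hω j k t] at hrev
    refine mul_left_cancel₀ hs.ne' ?_
    rw [← mul_assoc (√(ω k)) (√(ω k)), Real.mul_self_sqrt hk.1.le, hrev]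
    ring
  have hM₀ : 0 ≤ M := (mul_nonneg (Real.sqrt_nonneg t) hp).trans (hM k)
  calc √t * (ω j ^ 2 * symmetrizedFlow hω j t k ^ 2)
      = √(ω k) ^ 2 * ((√t * calP ω t j k) * calP ω t j k) := by
        rw [← mul_pow, hflow]; ring
    _ = ω k * ((√t * calP ω t j k) * calP ω t j k) := by rw [Real.sq_sqrt hk.1.le]
    _ ≤ 1 * (M * calP ω t j k) := by
        gcongr
        · linarith
        · exact hM k
    _ = M * calP ω t j k := one_mul _

end Regularity

/-- On the scale `√t` the rescaled kernel `√t ω p_t` is Hölder continuous of order `1 / 2`,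
uniformly in `t`. -/
lemma kernel_sub_sq_le {ω : ℤ → ℝ} (hω : ∀ k, 0 < ω k ∧ ω k ≤ 1 / 2) {M : ℝ}
    (hM : ∀ t : ℝ, 0 ≤ t → ∀ k : ℤ, √t * calP ω t 0 k ≤ M)
    {t : ℝ} (ht : 0 < t) (k j : ℤ) :
    √t * (√t * (ω k * calP ω t 0 k - ω j * calP ω t 0 j)) ^ 2 ≤ 2 * M * |(k : ℝ) - j| := by
  wlog hjk : j ≤ k generalizing k j
  · have := this j k (by omega)
    rwa [abs_sub_comm, ← neg_sub (ω k * calP ω t 0 k), mul_neg, neg_sq] at this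
  obtain ⟨n, rfl⟩ := Int.exists_add_of_le hjk
  have hosc := calP_sub_sq_le_energy hω t 0 j n
  have hen := energy_decay (weightedGradient ω hω) (hasDerivAt_symmetrizedFlow hω 0) ht
  have hnorm := norm_symmetrizedFlow_sq_le hω (half_pos ht).le (hM (t / 2) (half_pos ht).le)
  rw [calP_reversible, calP_reversible t 0 j, ← mul_sub, abs_of_nonneg (by simp)]
  have hsq : √t ≤ 2 * √(t / 2) := by
    refine Real.sqrt_le_iff.2 ⟨by positivity, ?_⟩
    rw [mul_pow, Real.sq_sqrt (half_pos ht).le]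
    linarith
  push_cast
  set D := ‖weightedGradient ω hω (symmetrizedFlow hω 0 t)‖ ^ 2
  set N := ‖symmetrizedFlow hω 0 (t / 2)‖ ^ 2
  calc √t * (√t * (ω 0 * (calP ω t (j + n) 0 - calP ω t j 0))) ^ 2
      = √t * (ω 0 ^ 2 * (t * (calP ω t (j + n) 0 - calP ω t j 0) ^ 2)) := by
        rw [mul_pow √t, Real.sq_sqrt ht.le]; ring
    _ ≤ 2 * √(t / 2) * (ω 0 ^ 2 * (t * (n * D))) := by gcongr
    _ = 2 * √(t / 2) * (ω 0 ^ 2 * (n * (t * D))) := by ring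
    _ ≤ 2 * √(t / 2) * (ω 0 ^ 2 * (n * N)) := by gcongr
    _ = 2 * n * (√(t / 2) * (ω 0 ^ 2 * N)) := by ring
    _ ≤ 2 * n * M := by gcongr
    _ = 2 * M * (j + n - j) := by ring

/-! ### Sums and integrals of lattice functions -/

lemma intervalIntegrable_comp_floor (g : ℤ → ℝ) {T a b : ℝ} (hT : 0 ≤ T) (hab : a ≤ b) :
    IntervalIntegrable (fun ξ => g ⌊T * ξ⌋) volume a b := by
  rw [intervalIntegrable_iff_integrableOn_Ioc_of_le hab]
  have hmeas : Measurable fun ξ : ℝ => g ⌊T * ξ⌋ :=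
    (measurable_from_top (f := g)).comp (measurable_const.mul measurable_id).floor
  refine Measure.integrableOn_of_bounded (M := ∑ k ∈ Finset.Icc ⌊T * a⌋ ⌊T * b⌋, |g k|)
    (by simp) hmeas.aestronglyMeasurable ?_
  filter_upwards [ae_restrict_mem measurableSet_Ioc] with ξ hξ
  refine Finset.single_le_sum (f := fun k => |g k|) (fun k _ => abs_nonneg _)
    (Finset.mem_Icc.2 ⟨Int.floor_mono ?_, Int.floor_mono ?_⟩)
  · exact mul_le_mul_of_nonneg_left hξ.1.le hT
  · exact mul_le_mul_of_nonneg_left hξ.2 hT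

lemma intervalIntegrable_floor (g : ℤ → ℝ) {a b : ℝ} (hab : a ≤ b) :
    IntervalIntegrable (fun s => g ⌊s⌋) volume a b := by
  simpa using intervalIntegrable_comp_floor g zero_le_one hab

lemma integral_floor_unit (g : ℤ → ℝ) (c : ℤ) : ∫ s in (c : ℝ)..(c + 1), g ⌊s⌋ = g c := by
  rw [intervalIntegral.integral_of_le (by linarith), ← integral_Ico_eq_integral_Ioc,
    setIntegral_congr_fun (g := fun _ => g c) measurableSet_Ico fun s hs => by
      simp only [Int.floor_eq_iff.2 hs]]
  simp

lemma integral_floor_add_eq_sum_Ioc (g : ℤ → ℝ) (a : ℤ) (n : ℕ) :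
    (∫ s in (a : ℝ)..((a + n : ℤ) : ℝ), g ⌊s⌋) + g (a + n) =
      ∑ k ∈ Finset.Ioc a (a + n), g k + g a := by
  induction n with
  | zero => simp
  | succ n ih =>
    have hIoc : Finset.Ioc a (a + (n + 1 : ℕ)) =
        insert (a + (n + 1 : ℕ)) (Finset.Ioc a (a + n)) := by
      ext k
      simp only [Finset.mem_insert, Finset.mem_Ioc]
      omega
    have hadj := intervalIntegral.integral_add_adjacent_intervals
      (intervalIntegrable_floor g (a := a) (b := ((a + n : ℤ) : ℝ)) (by push_cast; simp))
      (intervalIntegrable_floor g (a := ((a + n : ℤ) : ℝ)) (b := ((a + n : ℤ) : ℝ) + 1) (by simp))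
    rw [integral_floor_unit] at hadj
    have hcast : ((a + (n + 1 : ℕ) : ℤ) : ℝ) = ((a + n : ℤ) : ℝ) + 1 := by push_cast; ring
    rw [hIoc, Finset.sum_insert (by simp), hcast, ← hadj]
    linarith

lemma abs_integral_floor_sub_sum_le {g : ℤ → ℝ} {m : ℝ} (hg : ∀ k, 0 ≤ g k) (hm : ∀ k, g k ≤ m)
    {u v : ℝ} (huv : u ≤ v) :
    |(∫ s in u..v, g ⌊s⌋) - ∑ k ∈ Finset.Ioc ⌊u⌋ ⌊v⌋, g k| ≤ 4 * m := by
  obtain ⟨n, hn⟩ := Int.exists_add_of_le (Int.floor_mono huv)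
  have hsum := integral_floor_add_eq_sum_Ioc g ⌊u⌋ n
  rw [← hn] at hsum
  have hfl : (⌊u⌋ : ℝ) ≤ ⌊v⌋ := by exact_mod_cast Int.floor_mono huv
  have h₁ := intervalIntegral.integral_add_adjacent_intervals
    (intervalIntegrable_floor g (Int.floor_le u)) (intervalIntegrable_floor g huv)
  have h₂ := intervalIntegral.integral_add_adjacent_intervals
    (intervalIntegrable_floor g hfl) (intervalIntegrable_floor g (Int.floor_le v))
  have hfrac (r : ℝ) : |∫ s in (⌊r⌋ : ℝ)..r, g ⌊s⌋| ≤ m := by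
    have := intervalIntegral.norm_integral_le_of_norm_le_const (a := (⌊r⌋ : ℝ)) (b := r)
      (f := fun s => g ⌊s⌋) (C := m) fun s _ => by
        rw [Real.norm_of_nonneg (hg _)]; exact hm _
    have hr : |r - ⌊r⌋| ≤ 1 := by
      rw [abs_of_nonneg (by linarith [Int.floor_le r])]
      linarith [Int.lt_floor_add_one r]
    have hm₀ : 0 ≤ m := (hg 0).trans (hm 0)
    exact this.trans (mul_le_of_le_one_right hm₀ hr)
  have hu := abs_le.1 (hfrac u)
  have hv := abs_le.1 (hfrac v)
  rw [abs_le]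
  constructor <;> linarith [hg ⌊u⌋, hg ⌊v⌋, hm ⌊u⌋, hm ⌊v⌋]

lemma tsum_ite_le_sub {p : ℤ → ℝ} (hp : Summable p) {u v : ℝ} (huv : u ≤ v) :
    (∑' k : ℤ, if (k : ℝ) ≤ v then p k else 0) - (∑' k : ℤ, if (k : ℝ) ≤ u then p k else 0) =
      ∑ k ∈ Finset.Ioc ⌊u⌋ ⌊v⌋, p k := by
  have hs (r : ℝ) : Summable fun k : ℤ => if (k : ℝ) ≤ r then p k else 0 :=
    hp.indicator {k : ℤ | (k : ℝ) ≤ r}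
  rw [← (hs v).tsum_sub (hs u), tsum_eq_sum (s := Finset.Ioc ⌊u⌋ ⌊v⌋)]
  · refine Finset.sum_congr rfl fun k hk => ?_
    rw [Finset.mem_Ioc, Int.floor_lt, Int.le_floor] at hk
    rw [if_pos hk.2, if_neg hk.1.not_ge, sub_zero]
  · intro k hk
    rw [Finset.mem_Ioc, Int.floor_lt, Int.le_floor, not_and_or, not_lt, not_le] at hk
    rcases hk with hk | hk
    · rw [if_pos hk, if_pos (hk.trans huv), sub_self]
    · rw [if_neg hk.not_ge, if_neg (huv.trans_lt hk).not_ge, sub_self]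

/-! ### Local averages -/

lemma continuous_gauss (σ : ℝ) : Continuous (gauss σ) := by
  unfold gauss
  fun_prop

lemma integrable_gauss {σ : ℝ} (hσ : 0 < σ) : Integrable (gauss σ) := by
  have := (integrable_exp_neg_mul_sq (b := 1 / (2 * σ ^ 2)) (by positivity)).const_mul
    (1 / (Real.sqrt (2 * Real.pi) * σ))
  refine this.congr (.of_forall fun x => ?_)
  simp only [gauss]
  congr 2
  ring

lemma tendsto_integral_calP {ω : ℤ → ℝ} (hω : ∀ k, 0 < ω k ∧ ω k ≤ 1 / 2) {σ : ℝ} (hσ : 0 < σ)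
    (hA1 : ∀ x : ℝ,
      Tendsto (fun t : ℝ => ∑' k : ℤ, if (k : ℝ) ≤ Real.sqrt t * x then calP ω t 0 k else 0)
        atTop (𝓝 (∫ ξ in Set.Iic x, gauss σ ξ)))
    {M : ℝ} (hM : ∀ t : ℝ, 0 ≤ t → ∀ k : ℤ, √t * calP ω t 0 k ≤ M) {x y : ℝ} (hxy : x ≤ y) :
    Tendsto (fun t : ℝ => √t * ∫ ξ in x..y, calP ω t 0 ⌊√t * ξ⌋) atTop
      (𝓝 (∫ ξ in x..y, gauss σ ξ)) := by
  have hlim := (hA1 y).sub (hA1 x)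
  rw [intervalIntegral.integral_Iic_sub_Iic (integrable_gauss hσ).integrableOn
    (integrable_gauss hσ).integrableOn] at hlim
  have herr : Tendsto (fun t : ℝ => 4 * (M / √t)) atTop (𝓝 0) := by
    simpa using (Real.tendsto_sqrt_atTop.const_div_atTop M).const_mul 4
  refine hlim.congr_dist (squeeze_zero' (.of_forall fun _ => dist_nonneg) ?_ herr)
  filter_upwards [eventually_gt_atTop 0] with t ht
  have hs : 0 < √t := Real.sqrt_pos.2 ht
  have huv : √t * x ≤ √t * y := mul_le_mul_of_nonneg_left hxy hs.le
  rw [tsum_ite_le_sub (hasSum_calP hω ht.le 0).summable huv,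
    intervalIntegral.mul_integral_comp_mul_left (f := fun s => calP ω t 0 ⌊s⌋), dist_comm,
    Real.dist_eq]
  refine abs_integral_floor_sub_sum_le (calP_nonneg hω ht.le 0) (fun k => ?_) huv
  rw [le_div_iff₀' hs]
  exact hM t ht.le k

lemma abs_floor_sub_floor_le (u v : ℝ) : |(⌊u⌋ : ℝ) - ⌊v⌋| ≤ |u - v| + 1 := by
  have h₁ := Int.floor_le u
  have h₂ := Int.lt_floor_add_one u
  have h₃ := Int.floor_le v
  have h₄ := Int.lt_floor_add_one v
  have h₅ := le_abs_self (u - v)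
  have h₆ := neg_abs_le (u - v)
  rw [abs_le]
  constructor <;> linarith

/-- The kernel at a point is close to the ratio of local averages around this point. -/
lemma abs_kernel_sub_average_le {ω : ℤ → ℝ} (hω : ∀ k, 0 < ω k ∧ ω k ≤ 1 / 2)
    {M : ℝ} (hM : ∀ t : ℝ, 0 ≤ t → ∀ k : ℤ, √t * calP ω t 0 k ≤ M) {t x δ κ : ℝ} (ht : 0 < t)
    (hδ : 0 < δ) (htδ : 1 ≤ √t * δ) (hκ : 0 ≤ κ) (hδκ : 6 * M * δ ≤ κ ^ 2)
    (hA : 0 < ∫ ξ in (x - δ)..(x + δ), 1 / ω ⌊√t * ξ⌋)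
    {y : ℝ} (hy : y ∈ Set.Icc (x - δ) (x + δ)) :
    |ω ⌊√t * y⌋ * √t * calP ω t 0 ⌊√t * y⌋ -
      (√t * ∫ ξ in (x - δ)..(x + δ), calP ω t 0 ⌊√t * ξ⌋) /
        ∫ ξ in (x - δ)..(x + δ), 1 / ω ⌊√t * ξ⌋| ≤ κ := by
  have hs : 0 < √t := Real.sqrt_pos.2 ht
  have hab : x - δ ≤ x + δ := by linarith
  have hM₀ : 0 ≤ M := (mul_nonneg hs.le (calP_nonneg hω ht.le 0 0)).trans (hM t ht.le 0)
  set A := ∫ ξ in (x - δ)..(x + δ), 1 / ω ⌊√t * ξ⌋ with hAdef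
  set c := ω ⌊√t * y⌋ * √t * calP ω t 0 ⌊√t * y⌋ with hc
  have hint₁ := intervalIntegrable_comp_floor (fun k => 1 / ω k) hs.le hab
  have hint₂ := intervalIntegrable_comp_floor (calP ω t 0) hs.le hab
  have hosc : ∀ ξ ∈ Set.Icc (x - δ) (x + δ),
      |c - √t * (ω ⌊√t * ξ⌋ * calP ω t 0 ⌊√t * ξ⌋)| ≤ κ := fun ξ hξ => by
    have h := kernel_sub_sq_le hω hM ht ⌊√t * y⌋ ⌊√t * ξ⌋
    have hdist : |(⌊√t * y⌋ : ℝ) - ⌊√t * ξ⌋| ≤ √t * (3 * δ) := by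
      refine (abs_floor_sub_floor_le _ _).trans ?_
      rw [← mul_sub, abs_mul, abs_of_pos hs]
      have : |y - ξ| ≤ 2 * δ := by
        rw [abs_le]
        constructor <;> linarith [hξ.1, hξ.2, hy.1, hy.2]
      nlinarith [mul_le_mul_of_nonneg_left this hs.le]
    have h' : √t * (√t * (ω ⌊√t * y⌋ * calP ω t 0 ⌊√t * y⌋
        - ω ⌊√t * ξ⌋ * calP ω t 0 ⌊√t * ξ⌋)) ^ 2 ≤ √t * κ ^ 2 := by
      refine h.trans ((mul_le_mul_of_nonneg_left hdist (by positivity)).trans ?_)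
      nlinarith [mul_le_mul_of_nonneg_left hδκ hs.le]
    have h'' := abs_le_of_sq_le_sq (le_of_mul_le_mul_left h' hs) hκ
    have hfact : c - √t * (ω ⌊√t * ξ⌋ * calP ω t 0 ⌊√t * ξ⌋) = √t *
        (ω ⌊√t * y⌋ * calP ω t 0 ⌊√t * y⌋ - ω ⌊√t * ξ⌋ * calP ω t 0 ⌊√t * ξ⌋) := by
      rw [hc]
      ring
    rwa [hfact]
  have hdiff : c * A - √t * ∫ ξ in (x - δ)..(x + δ), calP ω t 0 ⌊√t * ξ⌋ =
      ∫ ξ in (x - δ)..(x + δ), (c * (1 / ω ⌊√t * ξ⌋) - √t * calP ω t 0 ⌊√t * ξ⌋) := by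
    rw [intervalIntegral.integral_sub (hint₁.const_mul c) (hint₂.const_mul √t),
      intervalIntegral.integral_const_mul, intervalIntegral.integral_const_mul]
  have hbound : |c * A - √t * ∫ ξ in (x - δ)..(x + δ), calP ω t 0 ⌊√t * ξ⌋| ≤ κ * A := by
    rw [hdiff, hAdef, ← intervalIntegral.integral_const_mul, ← Real.norm_eq_abs]
    refine intervalIntegral.norm_integral_le_of_norm_le hab
      (.of_forall fun ξ hξ => ?_) (hint₁.const_mul κ)
    have hpos := (hω ⌊√t * ξ⌋).1
    have hfact : c * (1 / ω ⌊√t * ξ⌋) - √t * calP ω t 0 ⌊√t * ξ⌋ =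
        (c - √t * (ω ⌊√t * ξ⌋ * calP ω t 0 ⌊√t * ξ⌋)) * (1 / ω ⌊√t * ξ⌋) := by
      field_simp
    rw [hfact, Real.norm_eq_abs, abs_mul, abs_of_pos (one_div_pos.2 hpos)]
    exact mul_le_mul_of_nonneg_right (hosc ξ (Set.Ioc_subset_Icc_self hξ))
      (one_div_pos.2 hpos).le
  rw [← mul_div_cancel_right₀ c hA.ne', ← sub_div, abs_div, abs_of_pos hA]
  exact (div_le_iff₀ hA).2 hbound

/-- The limit of the local averages is close to the rescaled Gaussian density. -/
lemma abs_gauss_average_sub_le {σ μ x δ η : ℝ} (hμ : 0 < μ) (hδ : 0 < δ)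
    (hη : ∀ y ∈ Set.Icc (x - δ) (x + δ), |gauss σ y - gauss σ x| ≤ η) :
    |(∫ ξ in (x - δ)..(x + δ), gauss σ ξ) / (2 * δ * μ) - 1 / μ * gauss σ x| ≤ η / μ := by
  have hab : x - δ ≤ x + δ := by linarith
  have hI := intervalIntegral.norm_integral_le_of_norm_le_const (a := x - δ) (b := x + δ)
    (f := fun ξ => gauss σ ξ - gauss σ x) (C := η) fun ξ hξ => by
      rw [Set.uIoc_of_le hab] at hξ
      exact hη ξ (Set.Ioc_subset_Icc_self hξ)
  rw [intervalIntegral.integral_sub ((continuous_gauss σ).intervalIntegrable _ _)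
    intervalIntegrable_const, intervalIntegral.integral_const, smul_eq_mul, Real.norm_eq_abs] at hI
  have hlen : x + δ - (x - δ) = 2 * δ := by ring
  rw [hlen, abs_of_pos (by positivity : 0 < 2 * δ)] at hI
  have hfact : (∫ ξ in (x - δ)..(x + δ), gauss σ ξ) / (2 * δ * μ) - 1 / μ * gauss σ x =
      ((∫ ξ in (x - δ)..(x + δ), gauss σ ξ) - 2 * δ * gauss σ x) / (2 * δ * μ) := by
    field_simp
  rw [hfact, abs_div, abs_of_pos (by positivity : 0 < 2 * δ * μ),
    div_le_div_iff₀ (by positivity) hμ]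
  nlinarith [mul_le_mul_of_nonneg_right hI hμ.le]

/-- **Theorem 1 (local limit theorem, continuous time).**
Assume (A1) the CLT for `Y_t/√t` with limit variance `σ²`, (A2) the averages
`(1/(y-x)) ∫_x^y dξ/ω_{⌊Tξ⌋}` converge to `μ > 0`, and (A3) the heat-kernel bound
`sup_{t ≥ 0} sup_k √t (𝒫^t)_{0,k} < ∞`.  Then
`ω_{⌊√t x⌋} · √t · ℙ^0(Y_t = ⌊√t x⌋) → φ_{σ²}(x)/μ` uniformly on compact sets. -/
theorem local_limit_theorem_continuous_time
    (ω : ℤ → ℝ) (hω : ∀ k : ℤ, 0 < ω k ∧ ω k ≤ 1 / 2)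
    (σ : ℝ) (hσ : 0 < σ)
    -- (A1): central limit theorem for `Y_t/√t`
    (hA1 : ∀ x : ℝ,
      Tendsto (fun t : ℝ => ∑' k : ℤ, if (k : ℝ) ≤ Real.sqrt t * x then calP ω t 0 k else 0)
        atTop (𝓝 (∫ ξ in Set.Iic x, gauss σ ξ)))
    (μ : ℝ) (hμ : 0 < μ)
    -- (A2): averaging of the environment
    (hA2 : ∀ x y : ℝ, x < y →
      Tendsto (fun T : ℝ => (1 / (y - x)) * ∫ ξ in x..y, 1 / ω ⌊T * ξ⌋)
        atTop (𝓝 μ))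
    -- (A3): heat-kernel bound
    (hA3 : ∃ M : ℝ, ∀ t : ℝ, 0 ≤ t → ∀ k : ℤ, Real.sqrt t * calP ω t 0 k ≤ M) :
    -- local limit theorem, uniformly on compact sets
    ∀ I : Set ℝ, IsCompact I → ∀ ε > 0, ∃ T : ℝ, ∀ t ≥ T, ∀ x ∈ I,
      |ω ⌊Real.sqrt t * x⌋ * Real.sqrt t * calP ω t 0 ⌊Real.sqrt t * x⌋
        - (1 / μ) * gauss σ x| < ε := by
  obtain ⟨M, hM⟩ := hA3
  have hM₀ : 0 ≤ M := (mul_nonneg (Real.sqrt_nonneg 0) (calP_nonneg hω le_rfl 0 0)).trans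
    (hM 0 le_rfl 0)
  intro I hI ε hε
  suffices h : ∀ᶠ t : ℝ in atTop, ∀ x ∈ I,
      |ω ⌊Real.sqrt t * x⌋ * Real.sqrt t * calP ω t 0 ⌊Real.sqrt t * x⌋
        - (1 / μ) * gauss σ x| < ε from eventually_atTop.1 h
  refine hI.induction_on (p := fun S => ∀ᶠ t : ℝ in atTop, ∀ x ∈ S,
      |ω ⌊Real.sqrt t * x⌋ * Real.sqrt t * calP ω t 0 ⌊Real.sqrt t * x⌋
        - (1 / μ) * gauss σ x| < ε) (by simp)
    (fun S S' hSS' h => h.mono fun t ht x hx => ht x (hSS' hx))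
    (fun S S' h h' => (h.and h').mono fun t ht x hx => hx.elim (ht.1 x) (ht.2 x)) fun x _ => ?_
  set η := μ * (ε / 8) with hη
  have hη₀ : 0 < η := by positivity
  obtain ⟨r, hr, hball⟩ := Metric.continuousAt_iff.1
    ((continuous_gauss σ).continuousAt (x := x)) η hη₀
  set δ := min (r / 2) ((ε / 4) ^ 2 / (6 * M + 1)) with hδdef
  have hδ : 0 < δ := by positivity
  have hδr : δ < r := (min_le_left _ _).trans_lt (half_lt_self hr)
  have hδκ : 6 * M * δ ≤ (ε / 4) ^ 2 := by
    have := (le_div_iff₀ (by positivity)).1 (min_le_right (r / 2) ((ε / 4) ^ 2 / (6 * M + 1)))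
    rw [← hδdef] at this
    linarith
  have hgauss : ∀ y ∈ Set.Icc (x - δ) (x + δ), |gauss σ y - gauss σ x| ≤ η := fun y hy => by
    refine (hball ?_).le
    rw [Real.dist_eq, abs_lt]
    constructor <;> linarith [hy.1, hy.2]
  refine ⟨Set.Icc (x - δ) (x + δ), mem_nhdsWithin_of_mem_nhds
    (Icc_mem_nhds (by linarith) (by linarith)), ?_⟩
  have hab : x - δ < x + δ := by linarith
  have hA : Tendsto (fun t : ℝ => ∫ ξ in (x - δ)..(x + δ), 1 / ω ⌊√t * ξ⌋) atTop
      (𝓝 (2 * δ * μ)) := by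
    have := ((hA2 _ _ hab).comp Real.tendsto_sqrt_atTop).const_mul (2 * δ)
    refine this.congr fun t => ?_
    have hlen : x + δ - (x - δ) = 2 * δ := by ring
    simp only [Function.comp, hlen]
    field_simp
  have hpos : 0 < 2 * δ * μ := by positivity
  have hJ := tendsto_integral_calP hω hσ hA1 hM hab.le
  have hratio := (Metric.tendsto_nhds.1 (hJ.div hA hpos.ne')) (ε / 4) (by positivity)
  filter_upwards [hratio, hA.eventually (lt_mem_nhds hpos), eventually_gt_atTop 0,
    Real.tendsto_sqrt_atTop.eventually_ge_atTop (1 / δ)] with t htr htA ht hts y hy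
  have hker := abs_le.1 (abs_kernel_sub_average_le hω hM ht hδ ((div_le_iff₀ hδ).1 hts)
    (by positivity : 0 ≤ ε / 4) hδκ htA hy)
  have hav := abs_le.1 (abs_gauss_average_sub_le hμ hδ hgauss)
  have hy' := abs_le.1 (hgauss y hy)
  rw [Real.dist_eq] at htr
  have htr' := abs_lt.1 htr
  have hημ : η / μ = ε / 8 := by rw [hη]; field_simp
  have hgy : 1 / μ * gauss σ y = 1 / μ * gauss σ x + (gauss σ y - gauss σ x) / μ := by ring
  have h₁ : (gauss σ y - gauss σ x) / μ ≤ ε / 8 := by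
    rw [← hημ]; exact div_le_div_of_nonneg_right hy'.2 hμ.le
  have h₂ : -(ε / 8) ≤ (gauss σ y - gauss σ x) / μ := by
    rw [← hημ, ← neg_div]; exact div_le_div_of_nonneg_right hy'.1 hμ.le
  rw [hημ] at hav
  simp only [Pi.div_apply] at htr'
  rw [hgy, abs_lt]
  constructor <;> linarith [hker.1, hker.2, hav.1, hav.2, htr'.1, htr'.2]
end

section
/- The map t ↦ ‖∇𝔞(t,·)‖²_{L²} is non-increasing on [0,∞). -/
open Filter MeasureTheory Topology

/-- The action of the balanced walk on gradients: `∇ (P u) = gradStep ω (∇ u)`. -/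
def gradStep (ω : ℤ → ℝ) (g : ℤ → ℝ) (k : ℤ) : ℝ :=
  g k + ω (k + 1) * (g (k + 1) - g k) - ω k * (g k - g (k - 1))

theorem gradStep_gradient_Ppow (ω : ℤ → ℝ) (n : ℕ) (j k : ℤ) :
    gradStep ω (fun i => Ppow ω n (i + 1) j - Ppow ω n i j) k =
      Ppow ω (n + 1) (k + 1) j - Ppow ω (n + 1) k j := by
  simp only [gradStep, Ppow, add_sub_cancel_right, sub_add_cancel]
  ring

/-- The square of `gradStep` is bounded by the square of `g` up to a telescoping term. -/
theorem gradStep_sq_le {ω : ℤ → ℝ} (hω : ∀ k, 0 ≤ ω k ∧ ω k ≤ 1 / 2) (g : ℤ → ℝ) (k : ℤ) :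
    gradStep ω g k ^ 2 ≤
      g k ^ 2 + (ω (k + 1) * (g (k + 1) ^ 2 - g k ^ 2) - ω k * (g k ^ 2 - g (k - 1) ^ 2)) := by
  have key (a h : ℝ) (ha : 0 ≤ a ∧ a ≤ 1 / 2) : 2 * (a * h) ^ 2 ≤ a * h ^ 2 := by
    nlinarith [mul_nonneg (mul_nonneg ha.1 (sub_nonneg.2 ha.2)) (sq_nonneg h)]
  have h₁ := key _ (g (k + 1) - g k) (hω (k + 1))
  have h₂ := key _ (g k - g (k - 1)) (hω k)
  have h₃ := sq_nonneg (ω (k + 1) * (g (k + 1) - g k) + ω k * (g k - g (k - 1)))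
  unfold gradStep
  linarith

theorem hasSum_telescope {g : ℤ → ℝ} (hg : Summable g) :
    HasSum (fun k => g (k + 1) - g k) 0 := by
  have h : HasSum (fun k => g (k + 1)) (∑' k, g k) :=
    (Equiv.addRight (1 : ℤ)).hasSum_iff.2 hg.hasSum
  simpa using h.sub hg.hasSum

theorem hasSum_gradStep_bound {ω : ℤ → ℝ} (hω : ∀ k, 0 ≤ ω k ∧ ω k ≤ 1 / 2) {g : ℤ → ℝ}
    (hg : Summable fun k => g k ^ 2) :
    HasSum (fun k => g k ^ 2 +
      (ω (k + 1) * (g (k + 1) ^ 2 - g k ^ 2) - ω k * (g k ^ 2 - g (k - 1) ^ 2)))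
      (∑' k, g k ^ 2) := by
  have hshift : Summable fun k => g (k - 1) ^ 2 := (Equiv.subRight (1 : ℤ)).summable_iff.2 hg
  have hflux : Summable fun k => ω k * (g k ^ 2 - g (k - 1) ^ 2) := by
    refine Summable.of_norm_bounded (hg.add hshift) fun k => ?_
    have := hω k
    rw [Real.norm_eq_abs, abs_le]
    constructor <;> nlinarith [sq_nonneg (g k), sq_nonneg (g (k - 1))]
  simpa using hg.hasSum.add (hasSum_telescope hflux)

theorem summable_gradStep_sq {ω : ℤ → ℝ} (hω : ∀ k, 0 ≤ ω k ∧ ω k ≤ 1 / 2) {g : ℤ → ℝ}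
    (hg : Summable fun k => g k ^ 2) : Summable fun k => gradStep ω g k ^ 2 :=
  (hasSum_gradStep_bound hω hg).summable.of_nonneg_of_le (fun _ => sq_nonneg _)
    (gradStep_sq_le hω g)

theorem tsum_gradStep_sq_le {ω : ℤ → ℝ} (hω : ∀ k, 0 ≤ ω k ∧ ω k ≤ 1 / 2) {g : ℤ → ℝ}
    (hg : Summable fun k => g k ^ 2) : ∑' k, gradStep ω g k ^ 2 ≤ ∑' k, g k ^ 2 :=
  hasSum_le (gradStep_sq_le hω g) (summable_gradStep_sq hω hg).hasSum
    (hasSum_gradStep_bound hω hg)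

theorem memlp_two_iff_summable_sq {g : ℤ → ℝ} :
    Memℓp g 2 ↔ Summable fun k => g k ^ 2 := by
  rw [memℓp_gen_iff (by norm_num)]
  simp

theorem lp_two_norm_sq (g : lp (fun _ : ℤ => ℝ) 2) : ‖g‖ ^ 2 = ∑' k, g k ^ 2 := by
  have h := lp.norm_rpow_eq_tsum (p := 2) (by norm_num) g
  simpa using h

/-- `gradStep` as a linear contraction of `ℓ²(ℤ)`. -/
noncomputable def gradStepCLM (ω : ℤ → ℝ) (hω : ∀ k, 0 ≤ ω k ∧ ω k ≤ 1 / 2) :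
    lp (fun _ : ℤ => ℝ) 2 →L[ℝ] lp (fun _ : ℤ => ℝ) 2 :=
  LinearMap.mkContinuous
    { toFun := fun g => ⟨gradStep ω g, memlp_two_iff_summable_sq.2
        (summable_gradStep_sq hω (memlp_two_iff_summable_sq.1 g.2))⟩
      map_add' := fun f g => by
        ext k
        simp only [gradStep, lp.coeFn_add, Pi.add_apply]
        ring
      map_smul' := fun c g => by
        ext k
        simp only [gradStep, lp.coeFn_smul, Pi.smul_apply, smul_eq_mul, RingHom.id_apply]
        ring }
    1 fun g => by
      rw [one_mul]
      refine le_of_sq_le_sq ?_ (norm_nonneg g)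
      rw [lp_two_norm_sq, lp_two_norm_sq]
      exact tsum_gradStep_sq_le hω (memlp_two_iff_summable_sq.1 g.2)

theorem gradStepCLM_apply (ω : ℤ → ℝ) (hω : ∀ k, 0 ≤ ω k ∧ ω k ≤ 1 / 2)
    (g : lp (fun _ : ℤ => ℝ) 2) (k : ℤ) : gradStepCLM ω hω g k = gradStep ω g k :=
  rfl

theorem norm_gradStepCLM_le (ω : ℤ → ℝ) (hω : ∀ k, 0 ≤ ω k ∧ ω k ≤ 1 / 2) :
    ‖gradStepCLM ω hω‖ ≤ 1 :=
  LinearMap.mkContinuous_norm_le _ zero_le_one _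

/-- The gradient of the indicator function of `j`, as an element of `ℓ²(ℤ)`. -/
noncomputable def gradIndicator (j : ℤ) : lp (fun _ : ℤ => ℝ) 2 :=
  lp.single 2 (j - 1) (1 : ℝ) - lp.single 2 j (1 : ℝ)

theorem gradStepCLM_pow_gradIndicator (ω : ℤ → ℝ) (hω : ∀ k, 0 ≤ ω k ∧ ω k ≤ 1 / 2) (n : ℕ)
    (j k : ℤ) :
    (gradStepCLM ω hω ^ n) (gradIndicator j) k = Ppow ω n (k + 1) j - Ppow ω n k j := by
  induction n generalizing k with
  | zero =>
    simp [gradIndicator, Ppow, lp.single_apply, Pi.single_apply, eq_sub_iff_add_eq]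
  | succ n ih =>
    rw [pow_succ', mul_apply_eq_comp, gradStepCLM_apply, funext ih,
      gradStep_gradient_Ppow]

theorem abs_Ppow_le_one {ω : ℤ → ℝ} (hω : ∀ k, 0 ≤ ω k ∧ ω k ≤ 1 / 2) (n : ℕ) (k j : ℤ) :
    |Ppow ω n k j| ≤ 1 := by
  induction n generalizing k with
  | zero =>
    rw [Ppow]
    split_ifs <;> simp
  | succ n ih =>
    have h₀ := hω k
    have h₁ := abs_le.1 (ih (k - 1))
    have h₂ := abs_le.1 (ih k)
    have h₃ := abs_le.1 (ih (k + 1))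
    rw [Ppow, abs_le]
    constructor <;> nlinarith

theorem summable_pow_div_factorial_mul_Ppow {ω : ℤ → ℝ} (hω : ∀ k, 0 ≤ ω k ∧ ω k ≤ 1 / 2) (t : ℝ)
    (k j : ℤ) : Summable fun n : ℕ => t ^ n / (Nat.factorial n) * Ppow ω n k j := by
  refine Summable.of_norm_bounded (Real.summable_pow_div_factorial t).norm fun n => ?_
  rw [norm_mul]
  exact mul_le_of_le_one_right (norm_nonneg _) (abs_Ppow_le_one hω n k j)

theorem gradient_calP_eq_exp (ω : ℤ → ℝ) (hω : ∀ k, 0 ≤ ω k ∧ ω k ≤ 1 / 2) (t : ℝ) (j k : ℤ) :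
    calP ω t (k + 1) j - calP ω t k j =
      (Real.exp (-t) • NormedSpace.exp (t • gradStepCLM ω hω) (gradIndicator j)) k := by
  have h := (NormedSpace.exp_series_hasSum_exp' (𝕂 := ℝ) (t • gradStepCLM ω hω)).mapL
    ((lp.evalCLM ℝ (fun _ : ℤ => ℝ) 2 k).comp (ContinuousLinearMap.apply ℝ _ (gradIndicator j)))
  have h' : HasSum (fun n : ℕ => t ^ n / (Nat.factorial n) *
      (Ppow ω n (k + 1) j - Ppow ω n k j))
      (NormedSpace.exp (t • gradStepCLM ω hω) (gradIndicator j) k) := by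
    refine h.congr_fun fun n => ?_
    rw [smul_pow, smul_smul, ← gradStepCLM_pow_gradIndicator ω hω, div_eq_inv_mul]
    rfl
  rw [lp.coeFn_smul, Pi.smul_apply, smul_eq_mul, ← h'.tsum_eq, calP, calP, ← mul_sub,
    ← (summable_pow_div_factorial_mul_Ppow hω t (k + 1) j).tsum_sub
      (summable_pow_div_factorial_mul_Ppow hω t k j)]
  simp only [mul_sub]

theorem norm_exp_smul_le {E : Type*} [NormedAddCommGroup E] [NormedSpace ℝ E] [CompleteSpace E]
    {A : E →L[ℝ] E} (hA : ‖A‖ ≤ 1) {t : ℝ} (ht : 0 ≤ t) (x : E) :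
    ‖NormedSpace.exp (t • A) x‖ ≤ Real.exp t * ‖x‖ := by
  have h := (NormedSpace.exp_series_hasSum_exp' (𝕂 := ℝ) (t • A)).mapL
    (ContinuousLinearMap.apply ℝ E x)
  have hexp : HasSum (fun n : ℕ => t ^ n / (Nat.factorial n) * ‖x‖) (Real.exp t * ‖x‖) := by
    rw [Real.exp_eq_exp_ℝ]
    exact (NormedSpace.expSeries_div_hasSum_exp t).mul_right _
  refine h.norm_le_of_bounded hexp fun n => ?_
  have hpow : ‖(A ^ n) x‖ ≤ ‖x‖ := by
    induction n with
    | zero => simp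
    | succ n ih =>
      rw [pow_succ', mul_apply_eq_comp]
      exact (A.le_of_opNorm_le hA _).trans (by rwa [one_mul])
  have heq : (ContinuousLinearMap.apply ℝ E x) ((Nat.factorial n : ℝ)⁻¹ • (t • A) ^ n) =
      (t ^ n / (Nat.factorial n)) • (A ^ n) x := by
    rw [smul_pow, smul_smul, div_eq_inv_mul]
    rfl
  rw [heq, norm_smul, Real.norm_of_nonneg (by positivity)]
  gcongr

theorem antitone_norm_exp_smul {E : Type*} [NormedAddCommGroup E] [NormedSpace ℝ E]
    [CompleteSpace E] {A : E →L[ℝ] E} (hA : ‖A‖ ≤ 1) (x : E) :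
    Antitone fun t : ℝ => ‖Real.exp (-t) • NormedSpace.exp (t • A) x‖ := by
  intro s t hst
  let _ : NormedAlgebra ℚ (E →L[ℝ] E) := NormedAlgebra.restrictScalars ℚ ℝ _
  have hsplit : NormedSpace.exp (t • A) =
      NormedSpace.exp ((t - s) • A) * NormedSpace.exp (s • A) := by
    rw [← NormedSpace.exp_add_of_commute (((Commute.refl A).smul_left _).smul_right _),
      ← add_smul, sub_add_cancel]
  simp only [norm_smul, Real.norm_eq_abs, Real.abs_exp]
  calc Real.exp (-t) * ‖NormedSpace.exp (t • A) x‖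
      ≤ Real.exp (-t) * (Real.exp (t - s) * ‖NormedSpace.exp (s • A) x‖) := by
        rw [hsplit, mul_apply_eq_comp]
        gcongr
        exact norm_exp_smul_le hA (sub_nonneg.2 hst) _
    _ = Real.exp (-s) * ‖NormedSpace.exp (s • A) x‖ := by
        rw [← mul_assoc, ← Real.exp_add]
        ring_nf

/-- **Lemma 1, second part.**  The map `t ↦ ‖∇𝔞(t,·)‖²_{L²}` is non-increasing on `[0,∞)`,
where `𝔞(t,k) = (𝒫^t)_{k,0}`. -/
theorem gradient_norm_nonincreasing_continuous
    (ω : ℤ → ℝ) (hω : ∀ k : ℤ, 0 < ω k ∧ ω k ≤ 1 / 2) :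
    AntitoneOn (fun t : ℝ => ∑' k : ℤ, (calP ω t (k + 1) 0 - calP ω t k 0) ^ 2)
      (Set.Ici (0 : ℝ)) := by
  have hω' : ∀ k, 0 ≤ ω k ∧ ω k ≤ 1 / 2 := fun k => ⟨(hω k).1.le, (hω k).2⟩
  intro s _ t _ hst
  simp only [gradient_calP_eq_exp ω hω', ← lp_two_norm_sq]
  exact pow_le_pow_left₀ (norm_nonneg _)
    (antitone_norm_exp_smul (norm_gradStepCLM_le ω hω') _ hst) 2
end

section
/- Suppose sup_{t>0} √t · (𝒫^t)_{0,0} < ∞. Then the functions f_t(x) = √t · 𝔞(t, ⌊√t·x⌋) are asymptotically equicontinuous in the sense that there exists a constant C > 0 such that, for every ε > 0 and all real x, y with |x − y| ≤ ε², and all t ≥ ε^{−4}, one has |f_t(x) − f_t(y)| ≤ C·ε. -/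
open Filter MeasureTheory Topology

open scoped InnerProductSpace

section HeatSemigroup

variable {H : Type*} [NormedAddCommGroup H] [InnerProductSpace ℝ H] [CompleteSpace H]

theorem hasDerivAt_exp_neg_smul_apply (L : H →L[ℝ] H) (w : H) (t : ℝ) :
    HasDerivAt (fun t : ℝ => NormedSpace.exp (-t • L) w)
      (-(L (NormedSpace.exp (-t • L) w))) t := by
  have h := hasDerivAt_exp_smul_const' (𝕂 := ℝ) L (-t)
  have h2 := (h.scomp t (hasDerivAt_neg t)).clm_apply (hasDerivAt_const t w)
  simpa [Function.comp_def] using h2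

/-- For `L = D†D`, the energy `‖D e^{-tL} w‖²` is nonincreasing in time. -/
theorem antitone_norm_sq_exp_neg_adjoint_comp_self (D : H →L[ℝ] H) (w : H) :
    Antitone fun t : ℝ => ‖D (NormedSpace.exp (-t • (D.adjoint * D)) w)‖ ^ 2 := by
  refine antitone_of_hasDerivAt_nonpos (f' := fun t =>
    2 * ⟪D (NormedSpace.exp (-t • (D.adjoint * D)) w),
      D (-((D.adjoint * D) (NormedSpace.exp (-t • (D.adjoint * D)) w)))⟫_ℝ)
    (fun t => ?_) fun t => ?_
  · exact (D.hasFDerivAt.comp_hasDerivAt t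
      (hasDerivAt_exp_neg_smul_apply (D.adjoint * D) w t)).norm_sq
  · beta_reduce
    rw [← ContinuousLinearMap.adjoint_inner_left, inner_neg_right, Pi.zero_apply]
    have := real_inner_self_nonneg
      (x := D.adjoint (D (NormedSpace.exp (-t • (D.adjoint * D)) w)))
    simp only [mul_apply_eq_comp] at this ⊢
    linarith

/-- The energy of the heat flow generated by `-D†D` is bounded by its on-diagonal part. -/
theorem mul_norm_sq_exp_neg_adjoint_comp_self_le (D : H →L[ℝ] H) (w : H) {t : ℝ} (ht : 0 < t) :
    t * ‖D (NormedSpace.exp (-t • (D.adjoint * D)) w)‖ ^ 2 ≤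
      ⟪w, NormedSpace.exp (-t • (D.adjoint * D)) w⟫_ℝ := by
  set L : H →L[ℝ] H := D.adjoint * D with hL
  have hderiv (s : ℝ) : HasDerivAt (fun s : ℝ => ‖NormedSpace.exp (-s • L) w‖ ^ 2)
      (-2 * ‖D (NormedSpace.exp (-s • L) w)‖ ^ 2) s := by
    convert (hasDerivAt_exp_neg_smul_apply L w s).norm_sq using 1
    rw [inner_neg_right, hL, mul_apply_eq_comp,
      ContinuousLinearMap.adjoint_inner_right, real_inner_self_eq_norm_sq]
    ring
  obtain ⟨c, hc, hslope⟩ := exists_hasDerivAt_eq_slope _ _ (half_lt_self ht)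
    (fun s _ => (hderiv s).continuousAt.continuousWithinAt) fun s _ => hderiv s
  have hmono : ‖D (NormedSpace.exp (-t • L) w)‖ ^ 2 ≤ ‖D (NormedSpace.exp (-c • L) w)‖ ^ 2 :=
    antitone_norm_sq_exp_neg_adjoint_comp_self D w hc.2.le
  have hself : IsSelfAdjoint (NormedSpace.exp (-(t / 2) • L)) :=
    ((IsSelfAdjoint.all (-(t / 2))).smul (IsSelfAdjoint.star_mul_self D)).exp
  have hdiag : ⟪w, NormedSpace.exp (-t • L) w⟫_ℝ =
      ‖NormedSpace.exp (-(t / 2) • L) w‖ ^ 2 := by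
    have hsplit : -t • L = -(t / 2) • L + -(t / 2) • L := by
      rw [← add_smul]; congr 1; ring
    let : NormedAlgebra ℚ (H →L[ℝ] H) := NormedAlgebra.restrictScalars ℚ ℝ (H →L[ℝ] H)
    rw [hsplit, NormedSpace.exp_add_of_commute (Commute.refl _), mul_apply_eq_comp,
      ← ContinuousLinearMap.adjoint_inner_left, ← ContinuousLinearMap.star_eq_adjoint,
      hself.star_eq, real_inner_self_eq_norm_sq]
  have ht2 : t - t / 2 = t / 2 := by ring
  rw [ht2, eq_div_iff (by positivity)] at hslope
  rw [hdiag]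
  nlinarith [sq_nonneg ‖NormedSpace.exp (-t • L) w‖]

end HeatSemigroup

section WeightedDifference

local notation "ℓ²ℤ" => lp (fun _ : ℤ => ℝ) 2

theorem lp_two_hasSum_sq (v : ℓ²ℤ) : HasSum (fun k => v k ^ 2) (‖v‖ ^ 2) := by
  simpa using lp.hasSum_norm (p := 2) (by simp) v

theorem weightedDifference_sq_le {s : ℤ → ℝ} (hs : ∀ k, s k ^ 2 ≤ 1) (v : ℤ → ℝ) (k : ℤ) :
    (s (k + 1) * v (k + 1) - s k * v k) ^ 2 ≤ 2 * v (k + 1) ^ 2 + 2 * v k ^ 2 := by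
  have h1 := mul_le_mul_of_nonneg_right (hs (k + 1)) (sq_nonneg (v (k + 1)))
  have h2 := mul_le_mul_of_nonneg_right (hs k) (sq_nonneg (v k))
  nlinarith [sq_nonneg (s (k + 1) * v (k + 1) + s k * v k)]

theorem hasSum_weightedDifference_bound (v : ℓ²ℤ) :
    HasSum (fun k => 2 * v (k + 1) ^ 2 + 2 * v k ^ 2) (4 * ‖v‖ ^ 2) := by
  have h := lp_two_hasSum_sq v
  have h1 : HasSum (fun k => v (k + 1) ^ 2) (‖v‖ ^ 2) :=
    (Equiv.addRight (1 : ℤ)).hasSum_iff.2 h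
  rw [show 4 * ‖v‖ ^ 2 = 2 * ‖v‖ ^ 2 + 2 * ‖v‖ ^ 2 by ring]
  exact (h1.mul_left 2).add (h.mul_left 2)

theorem memℓp_weightedDifference {s : ℤ → ℝ} (hs : ∀ k, s k ^ 2 ≤ 1) (v : ℓ²ℤ) :
    Memℓp (fun k => s (k + 1) * v (k + 1) - s k * v k) 2 :=
  memℓp_gen <| by
    simpa using Summable.of_nonneg_of_le (fun k => sq_nonneg _)
      (weightedDifference_sq_le hs v) (hasSum_weightedDifference_bound v).summable

/-- The linear map underlying `weightedDifference`. -/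
noncomputable def weightedDifferenceLinearMap (s : ℤ → ℝ) (hs : ∀ k, s k ^ 2 ≤ 1) :
    ℓ²ℤ →ₗ[ℝ] ℓ²ℤ where
  toFun v := ⟨fun k => s (k + 1) * v (k + 1) - s k * v k, memℓp_weightedDifference hs v⟩
  map_add' v w := by
    ext k
    simp only [lp.coeFn_add, Pi.add_apply]
    ring
  map_smul' c v := by
    ext k
    simp only [lp.coeFn_smul, Pi.smul_apply, smul_eq_mul, RingHom.id_apply]
    ring

theorem norm_weightedDifferenceLinearMap_le {s : ℤ → ℝ} (hs : ∀ k, s k ^ 2 ≤ 1) (v : ℓ²ℤ) :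
    ‖weightedDifferenceLinearMap s hs v‖ ≤ 2 * ‖v‖ := by
  have h : ‖weightedDifferenceLinearMap s hs v‖ ^ 2 ≤ 4 * ‖v‖ ^ 2 :=
    hasSum_le (weightedDifference_sq_le hs v)
      (lp_two_hasSum_sq (weightedDifferenceLinearMap s hs v)) (hasSum_weightedDifference_bound v)
  refine (sq_le_sq₀ (norm_nonneg _) (by positivity)).1 ?_
  linarith [mul_pow 2 ‖v‖ 2]

/-- The operator `(D v)_k = s_{k+1} v_{k+1} - s_k v_k` on `ℓ²(ℤ)`. -/
noncomputable def weightedDifference (s : ℤ → ℝ) (hs : ∀ k, s k ^ 2 ≤ 1) : ℓ²ℤ →L[ℝ] ℓ²ℤ :=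
  (weightedDifferenceLinearMap s hs).mkContinuous 2 (norm_weightedDifferenceLinearMap_le hs)

variable {s : ℤ → ℝ} (hs : ∀ k, s k ^ 2 ≤ 1)

theorem weightedDifference_apply (v : ℓ²ℤ) (k : ℤ) :
    weightedDifference s hs v k = s (k + 1) * v (k + 1) - s k * v k :=
  rfl

theorem weightedDifference_single (k : ℤ) :
    weightedDifference s hs (lp.single 2 k 1) =
      lp.single 2 (k - 1) (s k) - lp.single 2 k (s k) := by
  ext j
  rw [weightedDifference_apply, lp.coeFn_sub, Pi.sub_apply]
  simp only [lp.single_apply, Pi.single_apply]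
  by_cases h1 : j + 1 = k
  · subst h1; simp
  · have h1' : j ≠ k - 1 := by omega
    by_cases h2 : j = k
    · subst h2; simp [h1']
    · simp [h1, h1', h2]

theorem adjoint_weightedDifference_mul_self_apply (v : ℓ²ℤ) (k : ℤ) :
    ((weightedDifference s hs).adjoint * weightedDifference s hs) v k =
      2 * s k ^ 2 * v k - s k * s (k - 1) * v (k - 1) - s k * s (k + 1) * v (k + 1) := by
  have h := lp.inner_single_left (𝕜 := ℝ) k (1 : ℝ)
    (((weightedDifference s hs).adjoint * weightedDifference s hs) v)
  rw [mul_apply_eq_comp, ContinuousLinearMap.adjoint_inner_right,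
    weightedDifference_single, inner_sub_left, lp.inner_single_left, lp.inner_single_left,
    weightedDifference_apply, weightedDifference_apply] at h
  simp only [sub_add_cancel, RCLike.inner_apply, conj_trivial, mul_one] at h
  rw [mul_apply_eq_comp, ← h]
  ring

end WeightedDifference

section BalancedWalk

variable {ω : ℤ → ℝ}

/-- Conjugating the walk by `√ω` gives the self-adjoint operator `1 - D†D`. -/
theorem mul_one_sub_adjoint_mul_self_pow_single {s : ℤ → ℝ} (hs : ∀ k, s k ^ 2 ≤ 1)
    (hsω : ∀ k, s k ^ 2 = ω k) (n : ℕ) (k j : ℤ) :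
    s k * ((1 - (weightedDifference s hs).adjoint * weightedDifference s hs) ^ n)
      (lp.single 2 j 1) k = s j * Ppow ω n k j := by
  induction n generalizing k with
  | zero =>
    simp only [pow_zero, one_apply_eq_self, lp.single_apply, Pi.single_apply, Ppow]
    split_ifs with h
    · rw [h]
    · simp
  | succ n ih =>
    rw [pow_succ', mul_apply_eq_comp, sub_apply,
      one_apply_eq_self, lp.coeFn_sub, Pi.sub_apply,
      adjoint_weightedDifference_mul_self_apply, Ppow]
    have h0 := ih k
    have h1 := ih (k - 1)
    have h2 := ih (k + 1)
    rw [← hsω k]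
    linear_combination (1 - 2 * s k ^ 2) * h0 + s k ^ 2 * h1 + s k ^ 2 * h2

theorem mul_exp_neg_adjoint_mul_self_single {s : ℤ → ℝ} (hs : ∀ k, s k ^ 2 ≤ 1)
    (hsω : ∀ k, s k ^ 2 = ω k) {j : ℤ} (hj : s j ≠ 0) (t : ℝ) (k : ℤ) :
    s k * NormedSpace.exp (-t • ((weightedDifference s hs).adjoint * weightedDifference s hs))
      (lp.single 2 j 1) k = s j * calP ω t k j := by
  set L := (weightedDifference s hs).adjoint * weightedDifference s hs with hL
  have hsplit : -t • L = algebraMap ℝ _ (-t) + t • (1 - L) := by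
    rw [Algebra.algebraMap_eq_smul_one, smul_sub]
    module
  let : NormedAlgebra ℚ (lp (fun _ : ℤ => ℝ) 2 →L[ℝ] lp (fun _ : ℤ => ℝ) 2) :=
    NormedAlgebra.restrictScalars ℚ ℝ _
  have hexp : NormedSpace.exp (-t • L) = Real.exp (-t) • NormedSpace.exp (t • (1 - L)) := by
    rw [hsplit, NormedSpace.exp_add_of_commute (Algebra.commute_algebraMap_left _ _),
      ← NormedSpace.algebraMap_exp_comm, ← Real.exp_eq_exp_ℝ, Algebra.algebraMap_eq_smul_one,
      smul_mul_assoc, one_mul]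
  have hsum := ((((NormedSpace.exp_series_hasSum_exp' (𝕂 := ℝ) (t • (1 - L))).mapL
    (ContinuousLinearMap.apply ℝ _ (lp.single 2 j 1))).mapL
    (lp.evalCLM ℝ (fun _ : ℤ => ℝ) 2 k))).mul_left (s k / s j)
  have hterm (n : ℕ) : s k / s j * (lp.evalCLM ℝ (fun _ : ℤ => ℝ) 2 k)
      (ContinuousLinearMap.apply ℝ _ (lp.single 2 j 1) ((n.factorial⁻¹ : ℝ) • (t • (1 - L)) ^ n)) =
      t ^ n / n.factorial * Ppow ω n k j := by
    have h := mul_one_sub_adjoint_mul_self_pow_single hs hsω n k j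
    rw [← hL] at h
    simp only [smul_pow, ContinuousLinearMap.apply_apply, map_smul, smul_eq_mul]
    change s k / s j * ((n.factorial : ℝ)⁻¹ * (t ^ n * ((1 - L) ^ n) (lp.single 2 j 1) k)) = _
    field_simp
    linear_combination t ^ n * h
  simp only [hterm] at hsum
  rw [calP, hsum.tsum_eq, hexp]
  change s k * (Real.exp (-t) * NormedSpace.exp (t • (1 - L)) (lp.single 2 j 1) k) =
    s j * (Real.exp (-t) * (s k / s j * NormedSpace.exp (t • (1 - L)) (lp.single 2 j 1) k))
  field_simp

/-- Hölder-type bound: the spatial increments of the heat kernel are controlled by its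
on-diagonal values. -/
theorem calP_sub_sq_le (hω : ∀ k, 0 < ω k ∧ ω k ≤ 1 / 2) {t : ℝ} (ht : 0 < t) (k j : ℤ) (n : ℕ) :
    ω j * t * (calP ω t (k + n) j - calP ω t k j) ^ 2 ≤ n * calP ω t j j := by
  have hsω (k : ℤ) : √(ω k) ^ 2 = ω k := Real.sq_sqrt (hω k).1.le
  have hs (k : ℤ) : √(ω k) ^ 2 ≤ 1 := by linarith [hsω k, (hω k).2]
  have hj : √(ω j) ≠ 0 := (Real.sqrt_pos.2 (hω j).1).ne'
  set D := weightedDifference (fun k => √(ω k)) hs with hD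
  set v := NormedSpace.exp (-t • (D.adjoint * D)) (lp.single 2 j 1)
  have hcoord (k : ℤ) : √(ω k) * v k = √(ω j) * calP ω t k j :=
    mul_exp_neg_adjoint_mul_self_single hs hsω hj t k
  have hgrad (k : ℤ) : (D v k) ^ 2 = ω j * (calP ω t (k + 1) j - calP ω t k j) ^ 2 := by
    rw [hD, weightedDifference_apply, hcoord, hcoord]
    linear_combination (calP ω t (k + 1) j - calP ω t k j) ^ 2 * hsω j
  have henergy : t * ‖D v‖ ^ 2 ≤ calP ω t j j := by
    have h := mul_norm_sq_exp_neg_adjoint_comp_self_le D (lp.single 2 j (1 : ℝ)) ht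
    rw [lp.inner_single_left] at h
    simp only [RCLike.inner_apply, conj_trivial, mul_one] at h
    exact h.trans_eq (mul_left_cancel₀ hj (hcoord j))
  have hpart : ∑ i ∈ Finset.range n, (D v (k + i)) ^ 2 ≤ ‖D v‖ ^ 2 := by
    have h := lp_two_hasSum_sq (D v)
    have hinj : Function.Injective fun i : ℕ => k + (i : ℤ) := fun a b hab => by simpa using hab
    rw [← h.tsum_eq, ← Finset.sum_image (f := fun k => (D v k) ^ 2) hinj.injOn]
    exact h.summable.sum_le_tsum _ fun i _ => sq_nonneg _
  have htel : ∑ i ∈ Finset.range n, (calP ω t (k + i + 1) j - calP ω t (k + i) j) =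
      calP ω t (k + n) j - calP ω t k j := by
    simpa [add_assoc] using Finset.sum_range_sub (fun i : ℕ => calP ω t (k + i) j) n
  have hcs := sq_sum_le_card_mul_sum_sq (s := Finset.range n)
    (f := fun i : ℕ => calP ω t (k + i + 1) j - calP ω t (k + i) j)
  rw [htel, Finset.card_range] at hcs
  calc ω j * t * (calP ω t (k + n) j - calP ω t k j) ^ 2
      ≤ ω j * t * (n * ∑ i ∈ Finset.range n,
          (calP ω t (k + i + 1) j - calP ω t (k + i) j) ^ 2) :=
        mul_le_mul_of_nonneg_left hcs (mul_pos (hω j).1 ht).le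
    _ = n * (t * ∑ i ∈ Finset.range n, (D v (k + i)) ^ 2) := by
        simp only [hgrad, ← Finset.mul_sum]
        ring
    _ ≤ n * calP ω t j j := by
        gcongr
        exact (mul_le_mul_of_nonneg_left hpart ht.le).trans henergy

end BalancedWalk

/-- **Lemma 2 (asymptotic equicontinuity).**  Suppose `sup_{t>0} √t (𝒫^t)_{0,0} < ∞`.
Then, for `f_t(x) = √t · 𝔞(t, ⌊√t x⌋)` with `𝔞(t,k) = (𝒫^t)_{k,0}`, there exists `C > 0`
such that `|f_t(x) - f_t(y)| ≤ C ε` whenever `|x - y| ≤ ε²` and `t ≥ ε⁻⁴`. -/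
theorem asymptotic_equicontinuity_continuous
    (ω : ℤ → ℝ) (hω : ∀ k : ℤ, 0 < ω k ∧ ω k ≤ 1 / 2)
    (hker : ∃ M : ℝ, ∀ t : ℝ, 0 < t → Real.sqrt t * calP ω t 0 0 ≤ M) :
    ∃ C : ℝ, 0 < C ∧ ∀ ε : ℝ, 0 < ε → ∀ x y : ℝ, |x - y| ≤ ε ^ 2 →
      ∀ t : ℝ, t ≥ (ε ^ 4)⁻¹ →
        |Real.sqrt t * calP ω t ⌊Real.sqrt t * x⌋ 0
          - Real.sqrt t * calP ω t ⌊Real.sqrt t * y⌋ 0| ≤ C * ε := by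
  obtain ⟨M, hM⟩ := hker
  have hω0 := (hω 0).1
  refine ⟨√(2 * |M| / ω 0) + 1, by positivity, fun ε hε x y hxy t ht => ?_⟩
  wlog hle : y ≤ x generalizing x y with hsymm
  · rw [abs_sub_comm]
    exact hsymm y x (by rwa [abs_sub_comm]) (le_of_not_ge hle)
  have ht0 : 0 < t := lt_of_lt_of_le (by positivity) ht
  have hr0 : 0 < √t := Real.sqrt_pos.2 ht0
  have hrε : 1 ≤ √t * ε ^ 2 := by
    have h := Real.sqrt_le_sqrt ht
    rw [Real.sqrt_inv, show ε ^ 4 = (ε ^ 2) ^ 2 by ring, Real.sqrt_sq (by positivity)] at h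
    rwa [inv_le_iff_one_le_mul₀ (by positivity)] at h
  obtain ⟨n, hn⟩ := Int.eq_ofNat_of_zero_le
    (sub_nonneg.2 (Int.floor_mono (mul_le_mul_of_nonneg_left hle hr0.le)))
  have hk : ⌊√t * x⌋ = ⌊√t * y⌋ + n := by omega
  have hnle : (n : ℝ) ≤ 2 * (√t * ε ^ 2) := by
    have hcast : (n : ℝ) = ⌊√t * x⌋ - ⌊√t * y⌋ := by rw [hk]; push_cast; ring
    have hx := Int.floor_le (√t * x)
    have hy := Int.lt_floor_add_one (√t * y)
    have hd := mul_le_mul_of_nonneg_left ((le_abs_self _).trans hxy) hr0.le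
    linarith
  have hinc := calP_sub_sq_le hω ht0 ⌊√t * y⌋ 0 n
  rw [← hk] at hinc
  have hsq : (√t * calP ω t ⌊√t * x⌋ 0 - √t * calP ω t ⌊√t * y⌋ 0) ^ 2 ≤
      2 * |M| / ω 0 * ε ^ 2 := by
    have hdiag : √t * calP ω t 0 0 ≤ |M| := (hM t ht0).trans (le_abs_self M)
    have h : √t * (n * calP ω t 0 0) ≤ √t * (2 * |M| * ε ^ 2) :=
      calc √t * (n * calP ω t 0 0) = n * (√t * calP ω t 0 0) := by ring
        _ ≤ n * |M| := by gcongr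
        _ ≤ 2 * (√t * ε ^ 2) * |M| := by gcongr
        _ = √t * (2 * |M| * ε ^ 2) := by ring
    rw [← mul_sub, mul_pow, Real.sq_sqrt ht0.le, div_mul_eq_mul_div, le_div_iff₀ hω0]
    linarith [le_of_mul_le_mul_left h hr0]
  have habs := Real.abs_le_sqrt hsq
  rw [Real.sqrt_mul (by positivity), Real.sqrt_sq hε.le] at habs
  linarith
end
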